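/- For every a ∈ (0, 1/3) and every Okamoto function F with parameter a, the set of points x ∈ [0,1] at which F is differentiable within [0,1] with a nonzero derivative has Lebesgue measure 0. -/

import Mathlib

open Set MeasureTheory Filter

/-- `F : ℝ → ℝ` (regarded as a function on `[0,1]`) is an Okamoto function with
parameter `a` if it is continuous on `[0,1]` and satisfies the three self-affine
functional equations for all `x ∈ [0,1]`. -/
def IsOkamoto (a : ℝ) (F : ℝ → ℝ) : Prop :=
  ContinuousOn F (Set.Icc 0 1) ∧
  ∀ x ∈ Set.Icc (0 : ℝ) 1,
    F (x / 3) = a * F x ∧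
    F ((2 - x) / 3) = (2 * a - 1) * F x + (1 - a) ∧
    F ((2 + x) / 3) = a * F x + (1 - a)

namespace IsOkamoto

variable {a : ℝ} {F : ℝ → ℝ}

theorem map_zero (ha : a ∈ Ioo (0 : ℝ) (1 / 3)) (hF : IsOkamoto a F) : F 0 = 0 := by
  have h := (hF.2 0 (by simp)).1
  rw [zero_div] at h
  have h2 : (1 - a) * F 0 = 0 := by linarith
  exact (mul_eq_zero.1 h2).resolve_left (by linarith [ha.2])

theorem map_one (ha : a ∈ Ioo (0 : ℝ) (1 / 3)) (hF : IsOkamoto a F) : F 1 = 1 := by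
  have h := (hF.2 1 (by simp)).2.2
  rw [show ((2 : ℝ) + 1) / 3 = 1 by norm_num] at h
  have h2 : (1 - a) * (F 1 - 1) = 0 := by linarith
  have := (mul_eq_zero.1 h2).resolve_left (by linarith [ha.2])
  linarith

/-- Every point of `[0,1]` lies in one of the three pieces of length `1/3`, on which `F` is an
affine copy of itself. -/
theorem exists_piece (hF : IsOkamoto a F) {y : ℝ} (hy : y ∈ Icc (0 : ℝ) 1) :
    ∃ q σ c b z : ℝ, (σ = 1 / 3 ∧ c = a ∨ σ = -(1 / 3) ∧ c = 2 * a - 1) ∧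
      z ∈ Icc (0 : ℝ) 1 ∧ y = q + σ * z ∧
      ∀ t ∈ Icc (0 : ℝ) 1, q + σ * t ∈ Icc (0 : ℝ) 1 ∧ F (q + σ * t) = c * F t + b := by
  obtain ⟨h0, h1⟩ := hy
  rcases le_total y (1 / 3) with h | h
  · refine ⟨0, 1 / 3, a, 0, 3 * y, Or.inl ⟨rfl, rfl⟩, ⟨by linarith, by linarith⟩, by ring,
      fun t ht => ⟨⟨by linarith [ht.1], by linarith [ht.2]⟩, ?_⟩⟩
    rw [show 0 + 1 / 3 * t = t / 3 by ring, (hF.2 t ht).1, add_zero]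
  rcases le_total y (2 / 3) with h' | h'
  · refine ⟨2 / 3, -(1 / 3), 2 * a - 1, 1 - a, 2 - 3 * y, Or.inr ⟨rfl, rfl⟩,
      ⟨by linarith, by linarith⟩, by ring,
      fun t ht => ⟨⟨by linarith [ht.2], by linarith [ht.1]⟩, ?_⟩⟩
    rw [show 2 / 3 + -(1 / 3) * t = (2 - t) / 3 by ring, (hF.2 t ht).2.1]
  · refine ⟨2 / 3, 1 / 3, a, 1 - a, 3 * y - 2, Or.inl ⟨rfl, rfl⟩,
      ⟨by linarith, by linarith⟩, by ring,
      fun t ht => ⟨⟨by linarith [ht.1], by linarith [ht.2]⟩, ?_⟩⟩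
    rw [show 2 / 3 + 1 / 3 * t = (2 + t) / 3 by ring, (hF.2 t ht).2.2]

/-- Every point of `[0,1]` lies in an interval of length `3⁻ⁿ` on which `F` is an affine copy of
itself. -/
theorem exists_piece_pow (hF : IsOkamoto a F) {x : ℝ} (hx : x ∈ Icc (0 : ℝ) 1) (n : ℕ) :
    ∃ p s A B y : ℝ, |s| = (1 / 3) ^ n ∧ y ∈ Icc (0 : ℝ) 1 ∧ x = p + s * y ∧
      ∀ t ∈ Icc (0 : ℝ) 1, p + s * t ∈ Icc (0 : ℝ) 1 ∧ F (p + s * t) = A * F t + B := by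
  induction n with
  | zero => exact ⟨0, 1, 1, 0, x, by simp, hx, by ring, fun t ht => by simpa using ht⟩
  | succ n ih =>
    obtain ⟨p, s, A, B, y, hs, hy, rfl, h⟩ := ih
    obtain ⟨q, σ, c, b, z, hσ, hz, rfl, h'⟩ := hF.exists_piece hy
    have hσ' : |σ| = 1 / 3 := by
      rcases hσ with ⟨rfl, -⟩ | ⟨rfl, -⟩ <;> norm_num [abs_of_pos]
    refine ⟨p + s * q, s * σ, A * c, A * b + B, z, by rw [abs_mul, hs, hσ', pow_succ], hz,
      by ring, fun t ht => ?_⟩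
    obtain ⟨h1, h2⟩ := h _ (h' t ht).1
    rw [show p + s * q + s * σ * t = p + s * (q + σ * t) by ring]
    refine ⟨h1, ?_⟩
    rw [h2, (h' t ht).2]
    ring

/-- The derivative of an Okamoto function with parameter less than `1/3` vanishes wherever it
exists: the slopes of `F` over two consecutive nested pieces differ by a factor `3 * a` or `3 * (1 - 2 * a)`,
both bounded away from `1`. -/
theorem hasDerivWithinAt_eq_zero (ha : a ∈ Ioo (0 : ℝ) (1 / 3)) (hF : IsOkamoto a F) {x d : ℝ}
    (hx : x ∈ Icc (0 : ℝ) 1) (hd : HasDerivWithinAt F d (Icc 0 1) x) : d = 0 := by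
  by_contra hne
  have hdpos : 0 < |d| := abs_pos.2 hne
  have hk : 0 < 1 - 3 * a := by linarith [ha.2]
  set ε := (1 - 3 * a) * |d| / 4 with hε
  have hεpos : 0 < ε := by positivity
  have hlin := (hasDerivWithinAt_iff_isLittleO.1 hd).def hεpos
  obtain ⟨δ, hδ, hball⟩ := Metric.eventually_nhds_iff.1 (eventually_nhdsWithin_iff.1 hlin)
  obtain ⟨n, hn⟩ := exists_pow_lt_of_lt_one hδ (show (1 / 3 : ℝ) < 1 by norm_num)
  have chord : ∀ p s A B y : ℝ, |s| < δ → y ∈ Icc (0 : ℝ) 1 → x = p + s * y →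
      (∀ t ∈ Icc (0 : ℝ) 1, p + s * t ∈ Icc (0 : ℝ) 1 ∧ F (p + s * t) = A * F t + B) →
      |A - d * s| ≤ ε * |s| := by
    intro p s A B y hs hy hxy h
    obtain ⟨m0, e0⟩ := h 0 (by simp)
    obtain ⟨m1, e1⟩ := h 1 (by simp)
    rw [hF.map_zero ha] at e0
    rw [hF.map_one ha] at e1
    have d0 : p + s * 0 - x = -(s * y) := by rw [hxy]; ring
    have d1 : p + s * 1 - x = s * (1 - y) := by rw [hxy]; ring
    have a0 : |p + s * 0 - x| = |s| * y := by rw [d0, abs_neg, abs_mul, abs_of_nonneg hy.1]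
    have a1 : |p + s * 1 - x| = |s| * (1 - y) := by
      rw [d1, abs_mul, abs_of_nonneg (sub_nonneg.2 hy.2)]
    have b0 := hball (y := p + s * 0) (by
      rw [Real.dist_eq, a0]; nlinarith [abs_nonneg s, hy.2]) m0
    have b1 := hball (y := p + s * 1) (by
      rw [Real.dist_eq, a1]; nlinarith [abs_nonneg s, hy.1]) m1
    simp only [Real.norm_eq_abs, smul_eq_mul] at b0 b1
    rw [a0, d0, e0] at b0
    rw [a1, d1, e1] at b1
    have key : A - d * s = (A * 1 + B - F x - s * (1 - y) * d) -
        (A * 0 + B - F x - -(s * y) * d) := by ring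
    rw [key]
    refine (abs_sub _ _).trans ?_
    linarith
  obtain ⟨p, s, A, B, y, hs, hy, hxy, h⟩ := hF.exists_piece_pow hx n
  have hspos : 0 < |s| := by rw [hs]; positivity
  obtain ⟨q, σ, c, b, z, hσ, hz, rfl, h'⟩ := hF.exists_piece hy
  have hσ' : |σ| = 1 / 3 := by
    rcases hσ with ⟨rfl, -⟩ | ⟨rfl, -⟩ <;> norm_num [abs_of_pos]
  have outer := chord p s A B _ (hs ▸ hn) hy hxy h
  have inner := chord (p + s * q) (s * σ) (A * c) (A * b + B) z
    (by rw [abs_mul, hσ']; linarith) hz (by rw [hxy]; ring) (fun t ht => by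
      obtain ⟨h1, h2⟩ := h _ (h' t ht).1
      rw [show p + s * q + s * σ * t = p + s * (q + σ * t) by ring]
      refine ⟨h1, ?_⟩
      rw [h2, (h' t ht).2]
      ring)
  rw [abs_mul s, hσ'] at inner
  have hA : (1 - 3 * a) * |A| ≤ 2 * ε * |s| := by
    rw [← abs_of_pos hk, ← abs_mul]
    rw [abs_le] at outer inner ⊢
    have hεs : 0 < ε * |s| := by positivity
    rcases hσ with ⟨rfl, rfl⟩ | ⟨rfl, rfl⟩ <;> constructor <;> linarith
  have hlow : |d| * |s| - ε * |s| ≤ |A| := by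
    have := abs_sub_abs_le_abs_sub (d * s) A
    rw [abs_sub_comm, abs_mul] at this
    linarith
  have hmul := mul_le_mul_of_nonneg_left hlow hk.le
  have hds : 0 < (1 - 3 * a) * |d| * |s| := by positivity
  have := mul_pos hds ha.1
  rw [hε] at hA hmul
  nlinarith

end IsOkamoto

/-- For every `a ∈ (0,1/3)`, the set of points of `[0,1]` at which the Okamoto function
with parameter `a` is differentiable within `[0,1]` with nonzero derivative has Lebesgue
measure 0. -/
theorem okamoto_nonzero_deriv_measure_zero (a : ℝ) (ha : a ∈ Set.Ioo (0 : ℝ) (1 / 3))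
    (F : ℝ → ℝ) (hF : IsOkamoto a F) :
    volume {x ∈ Set.Icc (0 : ℝ) 1 |
      ∃ d : ℝ, d ≠ 0 ∧ HasDerivWithinAt F d (Set.Icc 0 1) x} = 0 := by
  convert measure_empty (μ := volume)
  refine eq_empty_of_forall_notMem ?_
  rintro x ⟨hx, d, hne, hd⟩
  exact hne (hF.hasDerivWithinAt_eq_zero ha hx hd)
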